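/- For all distinct nodes i ≠ j in N, the following identities hold in ℤ[[x]]: (i) m_{ij}^{¬{i}} · m_{ii} = m_{ij}; (ii) m_{ij}^{¬{j}} · m_{jj} = m_{ij}; (iii) m_{ij}^{¬{i,j}} · (m_{ii}·m_{jj} − m_{ij}·m_{ji}) = m_{ij}. (When G is symmetric these express the target centralities: the expected receptions under no retransmission by the sender, by the target, and by both equal m_{ij}/m_{ii}, m_{ij}/m_{jj}, and m_{ij}/(m_{ii}m_{jj} − m_{ij}²), respectively.) -/

import Mathlib

/-- The number of length-`t` walks from `i` to `j` in the graph with 0-1 adjacency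
matrix `G`. -/
def walkCount {n : ℕ} (G : Matrix (Fin n) (Fin n) ℤ) (i j : Fin n) (t : ℕ) : ℕ :=
  (Finset.univ.filter fun w : Fin (t + 1) → Fin n =>
    w 0 = i ∧ w (Fin.last t) = j ∧
      ∀ k : Fin t, G (w k.castSucc) (w k.succ) = 1).card

/-- The number of length-`t` walks from `i` to `j` none of whose intermediate nodes
lies in `A`. -/
def walkCountAvoid {n : ℕ} (G : Matrix (Fin n) (Fin n) ℤ) (A : Finset (Fin n))
    (i j : Fin n) (t : ℕ) : ℕ :=
  (Finset.univ.filter fun w : Fin (t + 1) → Fin n =>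
    w 0 = i ∧ w (Fin.last t) = j ∧
      (∀ k : Fin t, G (w k.castSucc) (w k.succ) = 1) ∧
      ∀ k : Fin (t + 1), k ≠ 0 → k ≠ Fin.last t → w k ∉ A).card

/-- `m_{ij}`. -/
noncomputable def mSer {n : ℕ} (G : Matrix (Fin n) (Fin n) ℤ) (i j : Fin n) :
    PowerSeries ℤ :=
  PowerSeries.mk fun t => (walkCount G i j t : ℤ)

/-- `m_{ij}^{¬A}`. -/
noncomputable def mAvoid {n : ℕ} (G : Matrix (Fin n) (Fin n) ℤ) (A : Finset (Fin n))
    (i j : Fin n) : PowerSeries ℤ :=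
  PowerSeries.mk fun t => (walkCountAvoid G A i j t : ℤ)

lemma mAvoid_empty {n : ℕ} (G : Matrix (Fin n) (Fin n) ℤ) (i j : Fin n) :
    mAvoid G ∅ i j = mSer G i j := by
  simp [mAvoid, mSer, walkCountAvoid, walkCount]

lemma walkCountAvoid_zero {n : ℕ} (G : Matrix (Fin n) (Fin n) ℤ) (A : Finset (Fin n))
    (i j : Fin n) : walkCountAvoid G A i j 0 = if i = j then 1 else 0 := by
  unfold walkCountAvoid
  split_ifs with h
  · subst h
    rw [Finset.card_eq_one]
    refine ⟨fun _ => i, ?_⟩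
    ext w
    simp only [Finset.mem_filter, Finset.mem_univ, true_and, Finset.mem_singleton]
    constructor
    · rintro ⟨h, -⟩
      funext k
      rw [Fin.fin_one_eq_zero k, h]
    · rintro rfl
      exact ⟨rfl, rfl, fun k => k.elim0, fun k hk => absurd (Fin.fin_one_eq_zero k) hk⟩
  · rw [Finset.card_eq_zero, Finset.filter_eq_empty_iff]
    rintro w - ⟨h0, h1, -⟩
    exact h (h0.symm.trans h1)

/-- Splitting off the first node of a walk. -/
lemma isWalkAvoid_cons_iff {n t : ℕ} (G : Matrix (Fin n) (Fin n) ℤ) (A : Finset (Fin n))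
    (i j x : Fin n) (w : Fin (t + 1) → Fin n) :
    ((Fin.cons x w : Fin (t + 2) → Fin n) 0 = i ∧
      (Fin.cons x w : Fin (t + 2) → Fin n) (Fin.last (t + 1)) = j ∧
      (∀ k : Fin (t + 1), G ((Fin.cons x w : Fin (t + 2) → Fin n) k.castSucc)
        ((Fin.cons x w : Fin (t + 2) → Fin n) k.succ) = 1) ∧
      ∀ k : Fin (t + 2), k ≠ 0 → k ≠ Fin.last (t + 1) →
        (Fin.cons x w : Fin (t + 2) → Fin n) k ∉ A) ↔
    x = i ∧ G i (w 0) = 1 ∧ w (Fin.last t) = j ∧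
      (∀ k : Fin t, G (w k.castSucc) (w k.succ) = 1) ∧
      ∀ k : Fin (t + 1), k ≠ Fin.last t → w k ∉ A := by
  rw [Fin.forall_fin_succ (n := t), Fin.forall_fin_succ (n := t + 1), ← Fin.succ_last]
  simp only [Fin.cons_zero, Fin.cons_succ, Fin.castSucc_zero, ← Fin.succ_castSucc,
    Fin.succ_inj, ne_eq, not_true_eq_false, false_imp_iff, true_and, Fin.succ_ne_zero,
    not_false_eq_true, true_imp_iff]
  constructor
  · rintro ⟨rfl, h1, ⟨h2, h3⟩, h4⟩
    exact ⟨rfl, h2, h1, h3, h4⟩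
  · rintro ⟨rfl, h2, h1, h3, h4⟩
    exact ⟨rfl, h1, ⟨h2, h3⟩, h4⟩

/-- Walks of length `t` from `l` to `j` all of whose nodes but the last avoid `A`. -/
lemma card_walks_avoid_start {n : ℕ} (G : Matrix (Fin n) (Fin n) ℤ) (A : Finset (Fin n))
    (l j : Fin n) (t : ℕ) :
    (Finset.univ.filter fun w : Fin (t + 1) → Fin n =>
      w 0 = l ∧ w (Fin.last t) = j ∧ (∀ k : Fin t, G (w k.castSucc) (w k.succ) = 1) ∧
      ∀ k : Fin (t + 1), k ≠ Fin.last t → w k ∉ A).card =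
    if l ∈ A then (if t = 0 ∧ l = j then 1 else 0) else walkCountAvoid G A l j t := by
  rcases Nat.eq_zero_or_pos t with rfl | ht
  · have h := walkCountAvoid_zero G A l j
    simp only [true_and]
    rw [h, ite_self, ← h, walkCountAvoid]
    congr 1
    ext w
    simp only [Finset.mem_filter, Finset.mem_univ, true_and]
    refine and_congr_right fun _ => and_congr_right fun _ => and_congr_right fun _ => ?_
    exact ⟨fun h k _ => h k, fun h k hk => absurd (Fin.fin_one_eq_zero k) hk⟩
  · have h0 : (0 : Fin (t + 1)) ≠ Fin.last t := by
      intro h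
      have := congrArg Fin.val h
      simp at this
      omega
    split_ifs with hl h
    · omega
    · rw [Finset.card_eq_zero, Finset.filter_eq_empty_iff]
      rintro w - ⟨rfl, -, -, h4⟩
      exact h4 0 h0 hl
    · rw [walkCountAvoid]
      congr 1
      ext w
      simp only [Finset.mem_filter, Finset.mem_univ, true_and]
      refine and_congr_right fun hw => and_congr_right fun _ => and_congr_right fun _ => ?_
      refine ⟨fun h k _ => h k, fun h k hk => ?_⟩
      by_cases hk0 : k = 0
      · rwa [hk0, hw]
      · exact h k hk0 hk

lemma walkCountAvoid_succ {n : ℕ} (G : Matrix (Fin n) (Fin n) ℤ)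
    (hG : ∀ i j, G i j = 0 ∨ G i j = 1) (A : Finset (Fin n)) (i j : Fin n) (t : ℕ) :
    (walkCountAvoid G A i j (t + 1) : ℤ) = ∑ l, G i l *
      (if l ∈ A then (if t = 0 ∧ l = j then 1 else 0) else walkCountAvoid G A l j t : ℤ) := by
  have key : ∀ l, G i l *
      (if l ∈ A then (if t = 0 ∧ l = j then 1 else 0) else walkCountAvoid G A l j t : ℤ) =
      ∑ w : Fin (t + 1) → Fin n, if w 0 = l then (if G i (w 0) = 1 ∧ w (Fin.last t) = j ∧
        (∀ k : Fin t, G (w k.castSucc) (w k.succ) = 1) ∧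
        ∀ k : Fin (t + 1), k ≠ Fin.last t → w k ∉ A then 1 else 0) else 0 := by
    intro l
    have h := congrArg (Nat.cast : ℕ → ℤ) (card_walks_avoid_start G A l j t)
    push_cast at h
    rw [← h, Finset.card_filter]
    push_cast
    rw [Finset.mul_sum]
    refine Finset.sum_congr rfl fun w _ => ?_
    by_cases hw : w 0 = l
    · subst hw
      rcases hG i (w 0) with h | h <;> simp [h]
    · simp [hw]
  rw [Finset.sum_congr rfl fun l _ => key l, Finset.sum_comm, walkCountAvoid,
    Finset.card_filter]
  push_cast
  rw [← (Fin.consEquiv fun _ : Fin (t + 2) => Fin n).sum_comp, Fintype.sum_prod_type]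
  simp only [Fin.consEquiv_apply, isWalkAvoid_cons_iff, ite_and]
  simp

open PowerSeries in
/-- First-step recursion. -/
lemma mAvoid_eq {n : ℕ} (G : Matrix (Fin n) (Fin n) ℤ)
    (hG : ∀ i j, G i j = 0 ∨ G i j = 1) (A : Finset (Fin n)) (i j : Fin n) :
    mAvoid G A i j = (if i = j then 1 else 0) + X * ∑ l, C (G i l) *
      (if l ∈ A then (if l = j then 1 else 0) else mAvoid G A l j) := by
  ext t
  rcases t with _ | t
  · simp only [mAvoid, coeff_mk, walkCountAvoid_zero, map_add, coeff_zero_X_mul, add_zero]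
    split_ifs <;> simp
  · have h1 : coeff (t + 1) (if i = j then 1 else 0 : PowerSeries ℤ) = 0 := by
      split_ifs <;> simp [coeff_one]
    rw [map_add, h1, zero_add, coeff_succ_X_mul, map_sum, mAvoid, coeff_mk,
      walkCountAvoid_succ G hG]
    refine Finset.sum_congr rfl fun l _ => ?_
    rw [coeff_C_mul]
    congr 1
    by_cases hl : l ∈ A
    · simp only [hl, if_true, ite_and]
      split_ifs <;> simp_all [coeff_one]
    · simp [hl, mAvoid]

open PowerSeries in
/-- Decomposition of a walk at its first visit to `A` after the start. -/
lemma mSer_eq_first_visit {n : ℕ} (G : Matrix (Fin n) (Fin n) ℤ)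
    (hG : ∀ i j, G i j = 0 ∨ G i j = 1) (A : Finset (Fin n)) (i j : Fin n) :
    mSer G i j = (if j ∈ A then (if i = j then 1 else 0) else mAvoid G A i j) +
      ∑ a ∈ A, (mAvoid G A i a - if i = a then 1 else 0) * mSer G a j := by
  set R : Fin n → PowerSeries ℤ := fun i =>
    (if j ∈ A then (if i = j then 1 else 0) else mAvoid G A i j) +
      ∑ a ∈ A, (mAvoid G A i a - if i = a then 1 else 0) * mSer G a j with hR
  have hm : ∀ k, mSer G k j = (if k = j then 1 else 0) + X * ∑ l, C (G k l) * mSer G l j := by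
    intro k
    simpa [mAvoid_empty] using mAvoid_eq G hG ∅ k j
  have hE : ∀ k, (if j ∈ A then (if k = j then 1 else 0) else mAvoid G A k j) =
      (if k = j then 1 else 0) + X * ∑ l, C (G k l) * (if l ∈ A then 0 else
        (if j ∈ A then (if l = j then 1 else 0) else mAvoid G A l j)) := by
    intro k
    by_cases hj : j ∈ A
    · have : ∀ l, (if l ∈ A then 0 else if l = j then 1 else 0 : PowerSeries ℤ) = 0 := by
        intro l
        split_ifs with h1 h2
        · rfl
        · exact absurd (h2 ▸ hj) h1
        · rfl
      simp [hj, this]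
    · simp only [hj, if_false]
      rw [mAvoid_eq G hG A k j]
      congr 2
      refine Finset.sum_congr rfl fun l _ => ?_
      congr 1
      split_ifs with h1 h2
      · exact absurd (h2 ▸ h1) hj
      · rfl
      · rfl
  have hP : ∀ k, ∑ a ∈ A, (mAvoid G A k a - if k = a then 1 else 0) * mSer G a j =
      X * ∑ l, C (G k l) * (if l ∈ A then mSer G l j else
        ∑ a ∈ A, (mAvoid G A l a - if l = a then 1 else 0) * mSer G a j) := by
    intro k
    have h : ∀ l, (if l ∈ A then mSer G l j else
        ∑ a ∈ A, (mAvoid G A l a - if l = a then 1 else 0) * mSer G a j) =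
        ∑ a ∈ A, (if l ∈ A then (if l = a then 1 else 0) else mAvoid G A l a) *
          mSer G a j := by
      intro l
      by_cases hl : l ∈ A
      · simp [hl]
      · simp only [hl, if_false]
        refine Finset.sum_congr rfl fun a ha => ?_
        have hla : l ≠ a := fun h => hl (h ▸ ha)
        rw [if_neg hla, sub_zero]
    simp only [h, Finset.mul_sum]
    rw [Finset.sum_comm]
    refine Finset.sum_congr rfl fun a _ => ?_
    rw [mAvoid_eq G hG A k a, add_sub_cancel_left, Finset.mul_sum, Finset.sum_mul]
    exact Finset.sum_congr rfl fun l _ => by ring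
  have hD : ∀ k, mSer G k j - R k =
      X * ∑ l, C (G k l) * (if l ∈ A then 0 else mSer G l j - R l) := by
    intro k
    simp only [hR]
    rw [hE k, hP k, hm k, add_assoc, ← mul_add, ← Finset.sum_add_distrib,
      add_sub_add_left_eq_sub, ← mul_sub, ← Finset.sum_sub_distrib]
    congr 1
    refine Finset.sum_congr rfl fun l _ => ?_
    rw [← mul_add, ← mul_sub]
    congr 1
    by_cases hl : l ∈ A <;> simp [hl]
  have h0 : ∀ t k, coeff t (mSer G k j - R k) = 0 := by
    intro t
    induction t with
    | zero => intro k; rw [hD, coeff_zero_X_mul]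
    | succ t ih =>
      intro k
      rw [hD, coeff_succ_X_mul, map_sum]
      refine Finset.sum_eq_zero fun l _ => ?_
      rw [coeff_C_mul]
      split_ifs
      · simp
      · rw [ih, mul_zero]
  exact sub_eq_zero.mp (PowerSeries.ext fun t => by rw [h0, map_zero])

/-- Target centralities: sender-only, target-only and sender-and-target
non-retransmission, in cleared-denominator form. -/
theorem stmt11 {n : ℕ} (hn : 0 < n) (G : Matrix (Fin n) (Fin n) ℤ)
    (hG : ∀ i j, G i j = 0 ∨ G i j = 1) (hdiag : ∀ i, G i i = 0)
    (i j : Fin n) (hij : i ≠ j) :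
    mAvoid G {i} i j * mSer G i i = mSer G i j ∧
    mAvoid G {j} i j * mSer G j j = mSer G i j ∧
    mAvoid G {i, j} i j * (mSer G i i * mSer G j j - mSer G i j * mSer G j i) =
      mSer G i j := by
  refine ⟨?_, ?_, ?_⟩
  · have h1 := mSer_eq_first_visit G hG {i} i j
    have h2 := mSer_eq_first_visit G hG {i} i i
    simp only [Finset.mem_singleton, hij.symm, if_true, if_false, Finset.sum_singleton] at h1 h2
    linear_combination mSer G i j * h2 - mSer G i i * h1
  · have h1 := mSer_eq_first_visit G hG {j} i j
    simp only [Finset.mem_singleton, hij, if_true, if_false, Finset.sum_singleton] at h1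
    linear_combination -h1
  · have h1 := mSer_eq_first_visit G hG {i, j} i j
    have h2 := mSer_eq_first_visit G hG {i, j} i i
    simp only [Finset.mem_insert, Finset.mem_singleton, hij, true_or, or_true, if_true,
      if_false, Finset.sum_pair hij] at h1 h2
    linear_combination mSer G i j * h2 - mSer G i i * h1
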